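/- arXiv:1505.06088 — 3 statements merged into one kernel-verified Lean document; each statement's English description precedes it below -/
import Mathlib

section
/- Let n ≥ 1, let ν be a finite Borel measure on ℝ^{n+1}, and let A ≥ 1. Then there is a constant C depending only on n and A such that: for all x, x' ∈ ℝ^{n+1} and all radii 0 < r ≤ r' satisfying ‖x − x'‖ ≤ A·r and r' ≤ A·r, one has ‖R_r ν(x) − R_{r'} ν(x')‖ ≤ C · sup_{t ≥ r} ν(B(x,t))/t^n. -/
open MeasureTheory Metric Set ENNReal

/-- The `ε`-truncated `n`-dimensional Riesz transform of `ν` at `x`. -/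
noncomputable def rieszTrunc (n : ℕ) (ν : MeasureTheory.Measure (EuclideanSpace ℝ (Fin (n+1))))
    (ε : ℝ) (x : EuclideanSpace ℝ (Fin (n+1))) : EuclideanSpace ℝ (Fin (n+1)) :=
  ∫ y in {y | ε < ‖x - y‖}, (‖x - y‖ ^ (n+1))⁻¹ • (x - y) ∂ν

/-- The indicator-truncated Riesz kernel is bounded by `ε⁻ⁿ`. -/
theorem norm_indicator_rieszKernel_le {E : Type*} [NormedAddCommGroup E] [NormedSpace ℝ E]
    (n : ℕ) {ε : ℝ} (hε : 0 < ε) (x y : E) :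
    ‖{y | ε < ‖x - y‖}.indicator (fun y => (‖x - y‖ ^ (n+1))⁻¹ • (x - y)) y‖ ≤ (ε ^ n)⁻¹ := by
  by_cases h : ε < ‖x - y‖
  · have hp : 0 < ‖x - y‖ := hε.trans h
    rw [indicator_of_mem (by exact h), norm_smul, Real.norm_of_nonneg (by positivity)]
    calc (‖x - y‖ ^ (n+1))⁻¹ * ‖x - y‖ = (‖x - y‖ ^ n)⁻¹ := by
          field_simp
          ring
      _ ≤ (ε ^ n)⁻¹ := by gcongr
  · rw [indicator_of_notMem (by exact h), norm_zero]
    positivity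

/-- Smoothness estimate for the kernel `u / ‖u‖ᵐ` away from the origin. -/
theorem norm_rieszKernel_sub_le {E : Type*} [NormedAddCommGroup E] [NormedSpace ℝ E]
    (n : ℕ) {u v : E} (hu : 0 < ‖u‖) (huv : ‖u - v‖ ≤ ‖u‖ / 2) :
    ‖(‖u‖ ^ (n+1))⁻¹ • u - (‖v‖ ^ (n+1))⁻¹ • v‖ ≤
      (2 ^ (n+1) + (n+1) * 2 ^ (2*n+1)) * ‖u - v‖ / ‖u‖ ^ (n+1) := by
  have hv : ‖u‖ / 2 ≤ ‖v‖ := by linarith [norm_sub_norm_le u v]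
  have hv' : ‖v‖ ≤ 2 * ‖u‖ := by
    have := norm_sub_norm_le v u
    rw [norm_sub_rev] at this
    linarith
  have hv0 : 0 < ‖v‖ := by linarith
  have hinv : (‖v‖ ^ (n+1))⁻¹ ≤ 2 ^ (n+1) / ‖u‖ ^ (n+1) := by
    rw [← div_pow, ← inv_pow]
    gcongr
    rw [inv_le_comm₀ hv0 (by positivity), inv_div]
    exact hv
  have hpow : |‖v‖ ^ (n+1) - ‖u‖ ^ (n+1)| ≤ ‖u - v‖ * (n+1) * (2 * ‖u‖) ^ n := by
    refine (abs_pow_sub_pow_le ‖v‖ ‖u‖ (n+1)).trans ?_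
    have h1 : |‖v‖ - ‖u‖| ≤ ‖u - v‖ := by
      rw [norm_sub_rev]; exact abs_norm_sub_norm_le v u
    have h2 : max |‖v‖| |‖u‖| ≤ 2 * ‖u‖ := by
      rw [abs_norm, abs_norm]; exact max_le hv' (by linarith)
    push_cast
    gcongr
  have hsplit : (‖u‖ ^ (n+1))⁻¹ • u - (‖v‖ ^ (n+1))⁻¹ • v =
      (‖v‖ ^ (n+1))⁻¹ • (u - v) +
        ((‖v‖ ^ (n+1) - ‖u‖ ^ (n+1)) * (‖u‖ ^ (n+1))⁻¹ * (‖v‖ ^ (n+1))⁻¹) • u := by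
    have : (‖v‖ ^ (n+1) - ‖u‖ ^ (n+1)) * (‖u‖ ^ (n+1))⁻¹ * (‖v‖ ^ (n+1))⁻¹ =
        (‖u‖ ^ (n+1))⁻¹ - (‖v‖ ^ (n+1))⁻¹ := by
      field_simp
    rw [this]
    module
  rw [hsplit]
  refine (norm_add_le _ _).trans ?_
  rw [norm_smul, norm_smul, norm_mul, norm_mul, Real.norm_eq_abs (_ - _),
    Real.norm_of_nonneg (by positivity : 0 ≤ (‖v‖ ^ (n+1))⁻¹),
    Real.norm_of_nonneg (by positivity : 0 ≤ (‖u‖ ^ (n+1))⁻¹)]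
  calc _ ≤ 2 ^ (n+1) / ‖u‖ ^ (n+1) * ‖u - v‖ + ‖u - v‖ * (n+1) * (2 * ‖u‖) ^ n *
        (‖u‖ ^ (n+1))⁻¹ * (2 ^ (n+1) / ‖u‖ ^ (n+1)) * ‖u‖ := by gcongr
    _ = _ := by
      field_simp
      ring

/-- The set integral defining `rieszTrunc` has an integrable integrand, for finite measures. -/
theorem integrable_indicator_rieszKernel (n : ℕ)
    (ν : Measure (EuclideanSpace ℝ (Fin (n+1)))) [IsFiniteMeasure ν] {ε : ℝ} (hε : 0 < ε)
    (x : EuclideanSpace ℝ (Fin (n+1))) :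
    Integrable ({y | ε < ‖x - y‖}.indicator (fun y => (‖x - y‖ ^ (n+1))⁻¹ • (x - y))) ν := by
  refine Integrable.of_bound (C := (ε ^ n)⁻¹) ?_
    (Filter.Eventually.of_forall (norm_indicator_rieszKernel_le n hε x))
  have hm : Measurable fun y : EuclideanSpace ℝ (Fin (n+1)) => (‖x - y‖ ^ (n+1))⁻¹ • (x - y) := by
    fun_prop
  exact (hm.indicator (measurableSet_lt (by fun_prop) (by fun_prop))).aestronglyMeasurable

/-- If `f` is dominated by `c k` on the `k`-th dyadic annulus around `x`, its integral is
controlled by the measures of the dyadic balls. -/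
theorem lintegral_le_tsum_dyadic {E : Type*} [NormedAddCommGroup E] [MeasurableSpace E]
    [OpensMeasurableSpace E] (ν : Measure E) (x : E) {R : ℝ} (hR : 0 < R) (f : E → ℝ≥0∞)
    (c : ℕ → ℝ≥0∞) (h0 : ∀ y, f y ≤ c 0)
    (hc : ∀ k y, 2 ^ k * R ≤ ‖x - y‖ → f y ≤ c (k+1)) :
    ∫⁻ y, f y ∂ν ≤ ∑' k, c k * ν (ball x (2 ^ k * R)) := by
  have hpt : ∀ y, f y ≤ ∑' k, (ball x (2 ^ k * R)).indicator (fun _ => c k) y := by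
    intro y
    have hex : ∃ k : ℕ, ‖x - y‖ < 2 ^ k * R := by
      obtain ⟨k, hk⟩ := pow_unbounded_of_one_lt (‖x - y‖ / R) one_lt_two
      exact ⟨k, (div_lt_iff₀ hR).1 hk⟩
    classical
    have hmem : y ∈ ball x (2 ^ Nat.find hex * R) := by
      rw [mem_ball', dist_eq_norm]
      exact Nat.find_spec hex
    refine le_trans ?_ (ENNReal.le_tsum (Nat.find hex))
    rw [indicator_of_mem hmem]
    rcases hk : Nat.find hex with _ | k
    · exact h0 y
    · exact hc k y (not_lt.1 (Nat.find_min hex (by omega)))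
  calc ∫⁻ y, f y ∂ν ≤ ∫⁻ y, ∑' k, (ball x (2 ^ k * R)).indicator (fun _ => c k) y ∂ν :=
        lintegral_mono hpt
    _ = ∑' k, ∫⁻ y, (ball x (2 ^ k * R)).indicator (fun _ => c k) y ∂ν :=
        lintegral_tsum fun k => (measurable_const.indicator measurableSet_ball).aemeasurable
    _ = _ := by
        congr with k
        exact lintegral_indicator_const measurableSet_ball _

/-- **Comparison of nearby truncated Riesz transforms.** For `n ≥ 1` and `A ≥ 1` there is a
constant `C = C(n, A)` such that for any finite Borel measure `ν` on `ℝ^{n+1}`, points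
`x, x'` and radii `0 < r ≤ r'` with `‖x − x'‖ ≤ A r` and `r' ≤ A r`,
`‖R_r ν(x) − R_{r'} ν(x')‖ ≤ C · sup_{t ≥ r} ν(B(x,t))/tⁿ`. -/
theorem riesz_trunc_comparison {n : ℕ} (hn : 1 ≤ n) (A : ℝ) (hA : 1 ≤ A) :
    ∃ C : ℝ, 0 < C ∧
      ∀ (ν : MeasureTheory.Measure (EuclideanSpace ℝ (Fin (n+1)))), IsFiniteMeasure ν →
      ∀ (x x' : EuclideanSpace ℝ (Fin (n+1))) (r r' : ℝ),
        0 < r → r ≤ r' → ‖x - x'‖ ≤ A * r → r' ≤ A * r →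
        ENNReal.ofReal ‖rieszTrunc n ν r x - rieszTrunc n ν r' x'‖ ≤
          ENNReal.ofReal C *
            ⨆ t : {t : ℝ // r ≤ t}, ν (Metric.ball x t.1) / ENNReal.ofReal (t.1 ^ n) := by
  have hA0 : 0 < A := by linarith
  set B : ℝ := 2 ^ (n+1) + (n+1) * 2 ^ (2*n+1) with hB
  have hB0 : 0 < B := by positivity
  set D : ℝ := 2 * (4 * A) ^ (n+1) + B * A * 2 ^ (n+1) with hD
  have hD0 : 0 < D := by positivity
  refine ⟨D / (4 * A) * 2, by positivity, ?_⟩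
  intro ν hν x x' r r' hr hrr' hxx' hr'A
  have hr' : 0 < r' := hr.trans_le hrr'
  set M := ⨆ t : {t : ℝ // r ≤ t}, ν (Metric.ball x t.1) / ENNReal.ofReal (t.1 ^ n)
  let F := {y | r < ‖x - y‖}.indicator (fun y => (‖x - y‖ ^ (n+1))⁻¹ • (x - y))
  let G := {y | r' < ‖x' - y‖}.indicator (fun y => (‖x' - y‖ ^ (n+1))⁻¹ • (x' - y))
  set R := 4 * A * r with hRdef
  have hR : 0 < R := by positivity
  have hrR : r ≤ R := by rw [hRdef]; nlinarith
  have hdiff : rieszTrunc n ν r x - rieszTrunc n ν r' x' = ∫ y, (F y - G y) ∂ν := by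
    rw [integral_sub (integrable_indicator_rieszKernel n ν hr x)
      (integrable_indicator_rieszKernel n ν hr' x'),
      integral_indicator (measurableSet_lt (by fun_prop) (by fun_prop)),
      integral_indicator (measurableSet_lt (by fun_prop) (by fun_prop))]
    rfl
  have hnear : ∀ y, ‖F y - G y‖ ≤ D * r / R ^ (n+1) := by
    intro y
    have h1 : ‖F y‖ ≤ (r ^ n)⁻¹ := norm_indicator_rieszKernel_le n hr x y
    have h2 : ‖G y‖ ≤ (r ^ n)⁻¹ :=
      (norm_indicator_rieszKernel_le n hr' x' y).trans (by gcongr)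
    calc ‖F y - G y‖ ≤ 2 * (r ^ n)⁻¹ := by linarith [norm_sub_le (F y) (G y)]
      _ = 2 * (4 * A) ^ (n+1) * r / R ^ (n+1) := by
        rw [hRdef, mul_pow (4 * A)]
        field_simp
        ring
      _ ≤ D * r / R ^ (n+1) := by
        gcongr
        rw [hD]
        exact le_add_of_nonneg_right (by positivity)
  have hfar : ∀ (k : ℕ) y, 2 ^ k * R ≤ ‖x - y‖ →
      ‖F y - G y‖ ≤ D * r / (2 ^ (k+1) * R) ^ (n+1) := by
    intro k y hy
    have hk : R ≤ 2 ^ k * R := le_mul_of_one_le_left hR.le (one_le_pow₀ one_le_two)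
    have hAr : 0 < A * r := by positivity
    have hy' : 4 * (A * r) ≤ ‖x - y‖ := by linarith
    have hrAr : r ≤ A * r := by nlinarith
    have hsub : (x - y) - (x' - y) = x - x' := by abel
    have htri : ‖x - y‖ - ‖x' - y‖ ≤ ‖x - x'‖ := hsub ▸ norm_sub_norm_le (x - y) (x' - y)
    have hFy : F y = (‖x - y‖ ^ (n+1))⁻¹ • (x - y) :=
      indicator_of_mem (s := {y | r < ‖x - y‖}) (by rw [mem_ofPred_eq]; linarith) _
    have hGy : G y = (‖x' - y‖ ^ (n+1))⁻¹ • (x' - y) :=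
      indicator_of_mem (s := {y | r' < ‖x' - y‖}) (by rw [mem_ofPred_eq]; linarith) _
    have hu : 0 < ‖x - y‖ := by linarith
    rw [hFy, hGy]
    refine (norm_rieszKernel_sub_le n hu (by rw [hsub]; linarith)).trans ?_
    rw [hsub, ← hB]
    calc B * ‖x - x'‖ / ‖x - y‖ ^ (n+1) ≤ B * (A * r) / (2 ^ k * R) ^ (n+1) := by gcongr
      _ = B * A * 2 ^ (n+1) * r / (2 ^ (k+1) * R) ^ (n+1) := by
        rw [pow_succ (2 : ℝ) k, mul_right_comm (2 ^ k), mul_pow _ (2 : ℝ)]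
        field_simp
      _ ≤ _ := by
        gcongr
        rw [hD]
        exact le_add_of_nonneg_left (by positivity)
  have hball : ∀ k : ℕ, ν (ball x (2 ^ k * R)) ≤ M * ENNReal.ofReal ((2 ^ k * R) ^ n) := by
    intro k
    have hk : R ≤ 2 ^ k * R := le_mul_of_one_le_left hR.le (one_le_pow₀ one_le_two)
    have h := le_iSup (fun t : {t : ℝ // r ≤ t} => ν (ball x t.1) / ENNReal.ofReal (t.1 ^ n))
      ⟨2 ^ k * R, hrR.trans hk⟩
    exact (ENNReal.div_le_iff (ENNReal.ofReal_pos.2 (by positivity)).ne' ofReal_ne_top).1 h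
  have hsum : HasSum (fun k : ℕ => D / (4 * A) * (1 / 2 : ℝ) ^ k) (D / (4 * A) * 2) :=
    hasSum_geometric_two.mul_left _
  rw [ofReal_norm, hdiff]
  calc ‖∫ y, (F y - G y) ∂ν‖ₑ ≤ ∫⁻ y, ‖F y - G y‖ₑ ∂ν := enorm_integral_le_lintegral_enorm _
    _ ≤ ∑' k, ENNReal.ofReal (D * r / (2 ^ k * R) ^ (n+1)) * ν (ball x (2 ^ k * R)) := by
      refine lintegral_le_tsum_dyadic ν x hR _ _ (fun y => ?_) (fun k y hy => ?_)
      · rw [← ofReal_norm, pow_zero, one_mul]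
        exact ENNReal.ofReal_le_ofReal (hnear y)
      · rw [← ofReal_norm]
        exact ENNReal.ofReal_le_ofReal (hfar k y hy)
    _ ≤ ∑' k : ℕ, ENNReal.ofReal (D / (4 * A) * (1 / 2 : ℝ) ^ k) * M := by
      refine ENNReal.tsum_le_tsum fun k => ?_
      calc _ ≤ ENNReal.ofReal (D * r / (2 ^ k * R) ^ (n+1)) *
            (M * ENNReal.ofReal ((2 ^ k * R) ^ n)) := by gcongr; exact hball k
        _ = ENNReal.ofReal (D * r / (2 ^ k * R) ^ (n+1) * (2 ^ k * R) ^ n) * M := by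
          rw [ENNReal.ofReal_mul (by positivity)]
          ring
        _ = _ := by
          congr 2
          rw [pow_succ _ n, one_div, inv_pow, hRdef]
          field_simp
    _ = ENNReal.ofReal (D / (4 * A) * 2) * M := by
      rw [ENNReal.tsum_mul_right, ← ENNReal.ofReal_tsum_of_nonneg (fun k => by positivity)
        hsum.summable, hsum.tsum_eq]
end

section
/- Let n ≥ 1. Let ω be a Borel measure on ℝ^{n+1} with total mass ω(ℝ^{n+1}) ≤ 1, let F ⊂ ℝ^{n+1} be a Borel set with H^n(F) < ∞, and let M ≥ 1 be such that H^n(H) ≤ M·ω(H) for every Borel set H ⊂ F. Let μ be a Borel measure supported on F with μ(F) = 1 and satisfying μ(B(x,r)) ≤ C₀·r^n for all x ∈ ℝ^{n+1} and r > 0. Let {Q_i}_{i∈I} be a countable family of pairwise disjoint Borel subsets of ℝ^{n+1} such that μ(Q_i) ≤ τ·ω(Q_i) for every i, where 0 < τ ≤ 1/2. Then ω(F \ ⋃_{i∈I} Q_i) ≥ c/(C₀·M), where c > 0 is a constant depending only on n. In particular ω(F \ ⋃_{i∈I} Q_i) > 0. -/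
open MeasureTheory Metric Set ENNReal

/-- The mass distribution principle: a measure satisfying the growth bound `μ (B(x, r)) ≤ C rⁿ`
is bounded by `C` times the `n`-dimensional Hausdorff measure. -/
theorem measure_le_mul_hausdorffMeasure_of_ball_le {X : Type*} [MetricSpace X]
    [MeasurableSpace X] [BorelSpace X] {n : ℕ} {μ : Measure X} {C : ℝ} (hC : 0 < C)
    (h : ∀ (x : X) (r : ℝ), 0 < r → μ (ball x r) ≤ ENNReal.ofReal (C * r ^ n)) (s : Set X) :
    μ s ≤ ENNReal.ofReal C * μH[(n : ℝ)] s := by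
  have hC0 : ENNReal.ofReal C ≠ 0 := by simpa using hC
  suffices hle : (ENNReal.ofReal C)⁻¹ • μ ≤ μH[(n : ℝ)] by
    have hs := hle s
    rw [Measure.smul_apply, smul_eq_mul] at hs
    exact (ENNReal.inv_mul_le_iff hC0 ofReal_ne_top).1 hs
  refine Measure.le_hausdorffMeasure _ _ 1 one_pos fun t ht ↦ ?_
  rw [Measure.smul_apply, smul_eq_mul, ENNReal.inv_mul_le_iff hC0 ofReal_ne_top,
    ENNReal.rpow_natCast]
  obtain rfl | ⟨x, hx⟩ := t.eq_empty_or_nonempty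
  · simp
  have hfin : ediam t ≠ ⊤ := (ht.trans_lt one_lt_top).ne
  have hbound : ∀ r, diam t < r → μ t ≤ ENNReal.ofReal (C * r ^ n) := fun r hr ↦ by
    refine (measure_mono fun y hy ↦ ?_).trans (h x r (diam_nonneg.trans_lt hr))
    exact (dist_le_diam_of_mem' hfin hy hx).trans_lt hr
  have hlim : Filter.Tendsto (fun r : ℝ ↦ ENNReal.ofReal (C * r ^ n))
      (nhdsWithin (diam t) (Ioi (diam t))) (nhds (ENNReal.ofReal (C * diam t ^ n))) := by
    have hcont : Continuous fun r : ℝ ↦ ENNReal.ofReal (C * r ^ n) :=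
      ENNReal.continuous_ofReal.comp (by fun_prop)
    exact hcont.continuousWithinAt
  refine (ge_of_tendsto hlim (Filter.eventually_of_mem self_mem_nhdsWithin hbound)).trans_eq ?_
  rw [ENNReal.ofReal_mul hC.le, ENNReal.ofReal_pow diam_nonneg, diam, ENNReal.ofReal_toReal hfin]

/-- **The complement of the low-measure cubes has positive harmonic measure.** Let `ω` be a
Borel measure on `ℝ^{n+1}` of total mass at most `1`, `F` Borel with `H^n(F) < ∞` and
`H^n(H) ≤ M ω(H)` for Borel `H ⊆ F`, and let `μ` be a Frostman probability measure on `F`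
with growth `μ(B(x,r)) ≤ C₀ rⁿ`. If `{Q i}` are pairwise disjoint Borel sets with
`μ(Q i) ≤ τ ω(Q i)` and `τ ≤ 1/2`, then `ω(F \ ⋃ Q i) ≥ c/(C₀ M) > 0` with `c = c(n)`. -/
theorem low_measure_cubes_complement {n : ℕ} (hn : 1 ≤ n) :
    ∃ c : ℝ, 0 < c ∧
      ∀ (ω μ : MeasureTheory.Measure (EuclideanSpace ℝ (Fin (n+1))))
        (F : Set (EuclideanSpace ℝ (Fin (n+1)))) (M C₀ τ : ℝ)
        (Q : ℕ → Set (EuclideanSpace ℝ (Fin (n+1)))),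
        ω Set.univ ≤ 1 →
        MeasurableSet F → μH[(n : ℝ)] F < ⊤ →
        1 ≤ M →
        (∀ H : Set (EuclideanSpace ℝ (Fin (n+1))), MeasurableSet H → H ⊆ F →
          μH[(n : ℝ)] H ≤ ENNReal.ofReal M * ω H) →
        μ Fᶜ = 0 → μ F = 1 →
        0 < C₀ →
        (∀ (x : EuclideanSpace ℝ (Fin (n+1))) (r : ℝ), 0 < r →
          μ (Metric.ball x r) ≤ ENNReal.ofReal (C₀ * r ^ n)) →
        0 < τ → τ ≤ 1 / 2 →
        (∀ i, MeasurableSet (Q i)) →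
        Pairwise (Function.onFun Disjoint Q) →
        (∀ i, μ (Q i) ≤ ENNReal.ofReal τ * ω (Q i)) →
        ENNReal.ofReal (c / (C₀ * M)) ≤ ω (F \ ⋃ i, Q i) ∧ 0 < ω (F \ ⋃ i, Q i) := by
  refine ⟨1 / 2, by norm_num, ?_⟩
  intro ω μ F M C₀ τ Q hω hF _ hM hH _ hF1 hC₀ hball _ hτ2 hQ hdisj hμQ
  have hM0 : 0 < M := one_pos.trans_le hM
  have hU : MeasurableSet (⋃ i, Q i) := .iUnion hQ
  have hτ' : ENNReal.ofReal τ ≤ 2⁻¹ := by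
    rw [← ENNReal.ofReal_ofNat 2, ← ENNReal.ofReal_inv_of_pos two_pos]
    exact ENNReal.ofReal_le_ofReal (by linarith)
  have hμU : μ (⋃ i, Q i) ≤ 2⁻¹ := by
    calc μ (⋃ i, Q i) ≤ ∑' i, μ (Q i) := measure_iUnion_le _
      _ ≤ ∑' i, ENNReal.ofReal τ * ω (Q i) := ENNReal.tsum_le_tsum hμQ
      _ = ENNReal.ofReal τ * ω (⋃ i, Q i) := by
        rw [ENNReal.tsum_mul_left, measure_iUnion hdisj hQ]
      _ ≤ 2⁻¹ * 1 := mul_le_mul' hτ' ((measure_mono (subset_univ _)).trans hω)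
      _ = 2⁻¹ := mul_one _
  have hμD : 2⁻¹ ≤ μ (F \ ⋃ i, Q i) := by
    calc (2⁻¹ : ENNReal) = 1 - 2⁻¹ := ENNReal.one_sub_inv_two.symm
      _ ≤ μ F - μ (⋃ i, Q i) := by rw [hF1]; exact tsub_le_tsub_left hμU 1
      _ ≤ μ (F \ ⋃ i, Q i) := le_measure_sdiff
  have hbound : ENNReal.ofReal (1 / 2 / (C₀ * M)) ≤ ω (F \ ⋃ i, Q i) := by
    rw [ENNReal.ofReal_div_of_pos (mul_pos hC₀ hM0)]
    refine ENNReal.div_le_of_le_mul' ?_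
    calc ENNReal.ofReal (1 / 2) = 2⁻¹ := by
          rw [one_div, ENNReal.ofReal_inv_of_pos two_pos, ENNReal.ofReal_ofNat]
      _ ≤ μ (F \ ⋃ i, Q i) := hμD
      _ ≤ ENNReal.ofReal C₀ * μH[(n : ℝ)] (F \ ⋃ i, Q i) :=
        measure_le_mul_hausdorffMeasure_of_ball_le hC₀ hball _
      _ ≤ ENNReal.ofReal C₀ * (ENNReal.ofReal M * ω (F \ ⋃ i, Q i)) :=
        mul_le_mul_right (hH _ (hF.diff hU) sdiff_subset) _
      _ = ENNReal.ofReal (C₀ * M) * ω (F \ ⋃ i, Q i) := by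
        rw [ENNReal.ofReal_mul hC₀.le, mul_assoc]
  exact ⟨hbound, lt_of_lt_of_le (by rw [ENNReal.ofReal_pos]; positivity) hbound⟩
end

section
/- (Frostman's lemma.) Let d ≥ 1, let s ∈ (0, d], and let F ⊂ ℝ^d be a compact set with H^s_∞(F) > 0. Then there exists a nonzero Borel measure μ supported on F such that μ(B(x,r)) ≤ r^s for all x ∈ ℝ^d and r > 0, and μ(F) ≥ c·H^s_∞(F) for a constant c > 0 depending only on d. -/
open MeasureTheory Metric Set ENNReal

/-- The `s`-dimensional Hausdorff content of `A`: the infimum of `∑ (diam Aᵢ)^s` over all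
countable covers of `A`. -/
noncomputable def hContent {d : ℕ} (s : ℝ) (A : Set (EuclideanSpace ℝ (Fin d))) : ℝ≥0∞ :=
  ⨅ (t : ℕ → Set (EuclideanSpace ℝ (Fin d))) (_ : A ⊆ ⋃ i, t i),
    ∑' i, EMetric.diam (t i) ^ s

open scoped CompactlySupported

/-- A nonnegative sublinear functional dominates some linear functional that agrees with it at a
given nonzero vector. -/
theorem exists_linearMap_le_sublinear_eq_at {E : Type*} [AddCommGroup E] [Module ℝ E] (p : E → ℝ)
    (p_hom : ∀ c : ℝ, 0 < c → ∀ x, p (c • x) = c * p x)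
    (p_add : ∀ x y, p (x + y) ≤ p x + p y) (p_nonneg : ∀ x, 0 ≤ p x) {e : E} (he : e ≠ 0) :
    ∃ g : E →ₗ[ℝ] ℝ, g e = p e ∧ ∀ x, g x ≤ p x := by
  obtain ⟨g, hg, hgp⟩ := exists_extension_of_le_sublinear
    (LinearPMap.mkSpanSingleton (K := ℝ) e (p e) he) p p_hom p_add (by
      rintro ⟨x, hx⟩
      obtain ⟨a, rfl⟩ := Submodule.mem_span_singleton.1 hx
      refine (LinearPMap.mkSpanSingleton'_apply (σ := RingHom.id ℝ) e (p e) _ a hx).trans_le ?_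
      rcases lt_or_ge 0 a with ha | ha
      · simp [p_hom a ha]
      · exact (mul_nonpos_of_nonpos_of_nonneg ha (p_nonneg e)).trans (p_nonneg _))
  refine ⟨g, ?_, hgp⟩
  rw [hg ⟨e, Submodule.mem_span_singleton_self e⟩]
  exact LinearPMap.mkSpanSingleton_apply _ _ he _

section FractionalCover

variable {ι X : Type*}

/-- The total weight `∑ cᵢ wᵢ` of a finitely supported family of coefficients. -/
noncomputable def fracCost (w : ι → ℝ) : (ι →₀ ℝ) →ₗ[ℝ] ℝ := Finsupp.linearCombination ℝ w

/-- The function `∑ cᵢ 1_{Bᵢ}`. -/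
noncomputable def fracCover (B : ι → Set X) : (ι →₀ ℝ) →ₗ[ℝ] (X → ℝ) :=
  Finsupp.linearCombination ℝ fun i => (B i).indicator 1

theorem fracCost_nonneg {w : ι → ℝ} (hw : ∀ i, 0 ≤ w i) {c : ι →₀ ℝ} (hc : 0 ≤ c) :
    0 ≤ fracCost w c := by
  rw [fracCost, Finsupp.linearCombination_apply]
  exact Finset.sum_nonneg fun i _ => mul_nonneg (hc i) (hw i)

@[simp]
theorem fracCost_single (w : ι → ℝ) (i : ι) (a : ℝ) :
    fracCost w (Finsupp.single i a) = a * w i := by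
  simp [fracCost]

@[simp]
theorem fracCover_single (B : ι → Set X) (i : ι) (a : ℝ) (x : X) :
    fracCover B (Finsupp.single i a) x = a * (B i).indicator 1 x := by
  simp [fracCover]

theorem exists_mem_of_fracCover_pos {B : ι → Set X} {c : ι →₀ ℝ} {x : X}
    (h : 0 < fracCover B c x) : ∃ i ∈ c.support, x ∈ B i := by
  by_contra! hx
  rw [fracCover, Finsupp.linearCombination_apply, Finsupp.sum, Finset.sum_apply] at h
  refine h.ne' (Finset.sum_eq_zero fun i hi => ?_)
  simp [hx i hi]

/-- The costs of the nonnegative fractional covers dominating `f`. -/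
def fracCoverCosts (B : ι → Set X) (w : ι → ℝ) (f : X → ℝ) : Set ℝ :=
  {v | ∃ c : ι →₀ ℝ, 0 ≤ c ∧ f ≤ fracCover B c ∧ fracCost w c = v}

/-- The least cost of a fractional cover dominating `f`. -/
noncomputable def fracGauge (B : ι → Set X) (w : ι → ℝ) (f : X → ℝ) : ℝ :=
  sInf (fracCoverCosts B w f)

variable {B : ι → Set X} {w : ι → ℝ}

theorem bddBelow_fracCoverCosts (hw : ∀ i, 0 ≤ w i) (f : X → ℝ) :
    BddBelow (fracCoverCosts B w f) :=
  ⟨0, by rintro _ ⟨c, hc, -, rfl⟩; exact fracCost_nonneg hw hc⟩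

theorem fracGauge_nonneg (hw : ∀ i, 0 ≤ w i) (f : X → ℝ) : 0 ≤ fracGauge B w f :=
  Real.sInf_nonneg (by rintro _ ⟨c, hc, -, rfl⟩; exact fracCost_nonneg hw hc)

theorem fracGauge_le (hw : ∀ i, 0 ≤ w i) {f : X → ℝ} {c : ι →₀ ℝ} (hc : 0 ≤ c)
    (hf : f ≤ fracCover B c) : fracGauge B w f ≤ fracCost w c :=
  csInf_le (bddBelow_fracCoverCosts hw f) ⟨c, hc, hf, rfl⟩

theorem fracCoverCosts_nonempty {i : ι} (hi : B i = univ) {f : X → ℝ}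
    (hf : BddAbove (range f)) : (fracCoverCosts B w f).Nonempty := by
  obtain ⟨M, hM⟩ := hf
  refine ⟨_, Finsupp.single i (max M 0), by simp, fun x => ?_, rfl⟩
  simp [hi, hM (mem_range_self x)]

theorem fracGauge_add_le (hw : ∀ i, 0 ≤ w i) {f g : X → ℝ}
    (hf : (fracCoverCosts B w f).Nonempty) (hg : (fracCoverCosts B w g).Nonempty) :
    fracGauge B w (f + g) ≤ fracGauge B w f + fracGauge B w g := by
  refine le_of_forall_pos_lt_add fun ε hε => ?_
  obtain ⟨_, ⟨a, ha, hfa, rfl⟩, ha'⟩ :=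
    exists_lt_of_csInf_lt hf (lt_add_of_pos_right (fracGauge B w f) (half_pos hε))
  obtain ⟨_, ⟨b, hb, hgb, rfl⟩, hb'⟩ :=
    exists_lt_of_csInf_lt hg (lt_add_of_pos_right (fracGauge B w g) (half_pos hε))
  have := fracGauge_le (B := B) (f := f + g) hw (add_nonneg ha hb)
    (by rw [map_add]; exact add_le_add hfa hgb)
  rw [map_add] at this
  linarith

theorem fracGauge_smul_le (hw : ∀ i, 0 ≤ w i) {f : X → ℝ}
    (hf : (fracCoverCosts B w f).Nonempty) {a : ℝ} (ha : 0 < a) :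
    fracGauge B w (a • f) ≤ a * fracGauge B w f := by
  rw [← div_le_iff₀' ha]
  refine le_csInf hf ?_
  rintro _ ⟨c, hc, hfc, rfl⟩
  rw [div_le_iff₀' ha, ← smul_eq_mul, ← map_smul]
  refine fracGauge_le hw (smul_nonneg ha.le hc) ?_
  rw [map_smul]
  exact smul_le_smul_of_nonneg_left hfc ha.le

/-- Duality between measures and fractional covers: if every fractional cover costs at least `τ`,
there is a measure of mass at least `τ` that gives each `Bᵢ` interior mass at most `wᵢ`. -/
theorem exists_measure_of_le_fracCost [TopologicalSpace X] [T2Space X] [CompactSpace X]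
    [Nonempty X] [MeasurableSpace X] [BorelSpace X] (hw : ∀ i, 0 ≤ w i)
    {i₀ : ι} (hi₀ : B i₀ = univ) {τ : ℝ}
    (hτ : ∀ c : ι →₀ ℝ, 0 ≤ c → 1 ≤ fracCover B c → τ ≤ fracCost w c) :
    ∃ μ : Measure X, ENNReal.ofReal τ ≤ μ univ ∧
      ∀ i U, IsOpen U → U ⊆ B i → μ U ≤ ENNReal.ofReal (w i) := by
  have hne (f : C_c(X, ℝ)) : (fracCoverCosts B w f).Nonempty :=
    fracCoverCosts_nonempty hi₀ (isCompact_range f.continuous).bddAbove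
  let e : C_c(X, ℝ) := ⟨1, HasCompactSupport.of_compactSpace 1⟩
  have he1 (x : X) : e x = 1 := rfl
  have he : e ≠ 0 := fun h => by
    simpa [he1] using DFunLike.congr_fun h (Classical.arbitrary X)
  obtain ⟨g, hge, hg⟩ := exists_linearMap_le_sublinear_eq_at
    (fun f : C_c(X, ℝ) => fracGauge B w f)
    (fun a ha f => by
      refine le_antisymm (fracGauge_smul_le hw (hne f) ha) ?_
      have := fracGauge_smul_le hw (hne (a • f)) (inv_pos.2 ha)
      rwa [CompactlySupportedContinuousMap.coe_smul, inv_smul_smul₀ ha.ne', le_inv_mul_iff₀ ha]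
        at this)
    (fun f₁ f₂ => fracGauge_add_le hw (hne f₁) (hne f₂))
    (fun f => fracGauge_nonneg hw f) he
  let Λ : C_c(X, ℝ) →ₚ[ℝ] ℝ := PositiveLinearMap.mk₀ g fun f hf => by
    have h : fracGauge B w (-f : C_c(X, ℝ)) ≤ fracCost w 0 :=
      fracGauge_le hw le_rfl fun x => by
        have : 0 ≤ f x := hf x
        simpa using this
    have := (hg (-f)).trans h
    simp only [map_neg, map_zero] at this
    linarith
  have hΛ (f : C_c(X, ℝ)) : Λ f = g f := rfl
  refine ⟨RealRMK.rieszMeasure Λ, ?_, fun i U hU hUB => ?_⟩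
  · have h1 : (RealRMK.rieszMeasure Λ).real univ = Λ e := by
      rw [← RealRMK.integral_rieszMeasure Λ e]
      simp [he1]
    rw [← ofReal_measureReal, h1, hΛ, hge]
    refine ENNReal.ofReal_le_ofReal (le_csInf (hne e) ?_)
    rintro _ ⟨c, hc, hfc, rfl⟩
    exact hτ c hc hfc
  · rw [hU.measure_eq_iSup_isCompact]
    refine iSup₂_le fun K hKU => iSup_le fun hK => ?_
    obtain ⟨f, hf1, hf0, -, hf⟩ := exists_continuous_one_zero_of_isCompact hK hU.isClosed_compl
      (disjoint_compl_right_iff_subset.2 hKU)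
    let f' : C_c(X, ℝ) := ⟨f, HasCompactSupport.of_compactSpace f⟩
    refine (RealRMK.rieszMeasure_le_of_eq_one Λ (f := f') (fun x => (hf x).1) hK hf1).trans
      (ENNReal.ofReal_le_ofReal ((hg f').trans ?_))
    have := fracGauge_le (B := B) (f := f') (c := Finsupp.single i 1) hw (by simp) fun x => by
      by_cases hx : x ∈ U
      · simpa [hUB hx] using! (hf x).2
      · have h0 : f' x = 0 := hf0 hx
        rw [h0]
        simpa using indicator_nonneg (f := (1 : X → ℝ)) (fun _ _ => zero_le_one) x
    simpa using this

end FractionalCover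

theorem hContent_le_sum {d : ℕ} {s : ℝ} (hs : 0 < s) {A : Set (EuclideanSpace ℝ (Fin d))}
    {ι : Type*} (S : Finset ι) (t : ι → Set (EuclideanSpace ℝ (Fin d)))
    (h : A ⊆ ⋃ i ∈ S, t i) : hContent s A ≤ ∑ i ∈ S, ediam (t i) ^ s := by
  let _ : Encodable S := Encodable.ofCountable S
  refine (iInf₂_le (fun n => ⋃ b ∈ Encodable.decode₂ S n, t b) ?_).trans_eq ?_
  · rw [Encodable.iUnion_decode₂]
    exact h.trans (by simp [iUnion_subtype])
  · change ∑' n, ediam (⋃ b ∈ Encodable.decode₂ S n, t b) ^ s = _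
    rw [tsum_iUnion_decode₂ (fun u => ediam u ^ s) (by simp [hs]) fun b : S => t b,
      tsum_fintype, Finset.sum_coe_sort S fun i => ediam (t i) ^ s]

theorem hContent_le_ofReal_sum {d : ℕ} {s : ℝ} (hs : 0 < s)
    {A : Set (EuclideanSpace ℝ (Fin d))} (S : Finset (EuclideanSpace ℝ (Fin d) × NNReal))
    (h : A ⊆ ⋃ q ∈ S, closedBall q.1 (5 * q.2)) :
    hContent s A ≤ ENNReal.ofReal (10 ^ s * ∑ q ∈ S, (q.2 : ℝ) ^ s) := by
  refine (hContent_le_sum hs S _ h).trans ?_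
  rw [Finset.mul_sum, ENNReal.ofReal_sum_of_nonneg fun q _ => by positivity]
  refine Finset.sum_le_sum fun q _ => ?_
  rw [← Real.mul_rpow (by norm_num) q.2.coe_nonneg, ← ENNReal.ofReal_rpow_of_nonneg (by positivity) hs.le]
  refine ENNReal.rpow_le_rpow ?_ hs.le
  refine ediam_le fun x hx y hy => ?_
  rw [edist_dist]
  refine ENNReal.ofReal_le_ofReal ((dist_triangle_right x y q.1).trans ?_)
  linarith [mem_closedBall.1 hx, mem_closedBall.1 hy]

/-- Fractional covers by balls are, up to the factor `10 ^ s`, no cheaper than genuine covers.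
Disjoint subfamilies from the Vitali covering lemma are peeled off one after another. -/
theorem mul_hContent_le_fracCost {d : ℕ} {s : ℝ} (hs : 0 < s)
    (F : Set (EuclideanSpace ℝ (Fin d))) (c : EuclideanSpace ℝ (Fin d) × NNReal →₀ ℝ)
    (hc : 0 ≤ c) (a : ℝ)
    (ha : ∀ x ∈ F, a ≤ fracCover
      (fun q : EuclideanSpace ℝ (Fin d) × NNReal => closedBall q.1 (q.2 : ℝ)) c x) :
    a * (hContent s F).toReal ≤ 10 ^ s * fracCost (fun q => (q.2 : ℝ) ^ s) c := by
  classical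
  induction hn : c.support.card using Nat.strong_induction_on generalizing c a with
  | _ n ih =>
  set w : EuclideanSpace ℝ (Fin d) × NNReal → ℝ := fun q => (q.2 : ℝ) ^ s
  set B : EuclideanSpace ℝ (Fin d) × NNReal → Set (EuclideanSpace ℝ (Fin d)) :=
    fun q => closedBall q.1 (q.2 : ℝ)
  have hcost : 0 ≤ 10 ^ s * fracCost w c :=
    mul_nonneg (by positivity) (fracCost_nonneg (fun q => by positivity) hc)
  rcases le_or_gt a 0 with ha0 | ha0
  · exact (mul_nonpos_of_nonpos_of_nonneg ha0 toReal_nonneg).trans hcost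
  rcases F.eq_empty_or_nonempty with rfl | ⟨x₀, hx₀⟩
  · have : hContent s (∅ : Set (EuclideanSpace ℝ (Fin d))) = 0 := by
      simpa using hContent_le_sum hs (∅ : Finset ℕ) (fun _ => ∅) (empty_subset _)
    simpa [this] using hcost
  obtain ⟨u, hu, hdisj, hcov⟩ := Vitali.exists_disjoint_subfamily_covering_enlargement_closedBall
    (c.support : Set (EuclideanSpace ℝ (Fin d) × NNReal)) (fun q => q.1) (fun q => (q.2 : ℝ))
    (c.support.sup fun q => q.2 : NNReal)
    (fun q hq => NNReal.coe_le_coe.2 (Finset.le_sup (f := fun q => q.2) hq)) 5 (by norm_num)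
  lift u to Finset (EuclideanSpace ℝ (Fin d) × NNReal) using c.support.finite_toSet.subset hu
  have hcovF : F ⊆ ⋃ q ∈ u, closedBall q.1 (5 * q.2) := fun x hx => by
    obtain ⟨q, hq, hxq⟩ := exists_mem_of_fracCover_pos (ha0.trans_le (ha x hx))
    obtain ⟨b, hb, hqb⟩ := hcov q hq
    exact mem_iUnion₂.2 ⟨b, hb, hqb hxq⟩
  have hune : u.Nonempty := by
    obtain ⟨b, hb, -⟩ := mem_iUnion₂.1 (hcovF hx₀)
    exact ⟨b, hb⟩
  obtain ⟨m, hm, hmin⟩ := u.exists_min_image c hune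
  set e : EuclideanSpace ℝ (Fin d) × NNReal →₀ ℝ := ∑ q ∈ u, Finsupp.single q (c m)
  have he (q) : e q = if q ∈ u then c m else 0 := by
    simp [e, Finsupp.finsetSum_apply, Finsupp.single_apply]
  have hcm : 0 ≤ c m := hc m
  have hc' : 0 ≤ c - e := fun q => by
    rw [Finsupp.coe_zero, Pi.zero_apply, Finsupp.sub_apply, he]
    split_ifs with hq
    · exact sub_nonneg.2 (hmin q hq)
    · simpa using hc q
  have hsupp : (c - e).support ⊂ c.support := by
    refine Finset.ssubset_iff_subset_ne.2 ⟨fun q hq => ?_, fun h => ?_⟩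
    · by_contra hqc
      have hqu : q ∉ u := fun hqu => hqc (hu hqu)
      rw [Finsupp.mem_support_iff, Finsupp.sub_apply, he, if_neg hqu,
        Finsupp.notMem_support_iff.1 hqc] at hq
      simp at hq
    · have hmc : m ∈ (c - e).support := h ▸ hu hm
      simp [he, hm] at hmc
  have hcover (x) : fracCover B e x ≤ c m := by
    have hsum : fracCover B e x = c m * ∑ q ∈ u, (B q).indicator 1 x := by
      simp [e, Finset.mul_sum]
    rw [hsum]
    refine mul_le_of_le_one_right hcm ?_
    by_cases hx : ∃ q ∈ u, x ∈ B q
    · obtain ⟨q, hq, hxq⟩ := hx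
      rw [Finset.sum_eq_single_of_mem q hq fun b hb hbq => indicator_of_notMem
        (fun hxb => disjoint_left.1 (hdisj hb hq hbq) hxb hxq) _]
      rw [indicator_of_mem hxq, Pi.one_apply]
    · push Not at hx
      rw [Finset.sum_eq_zero fun q hq => indicator_of_notMem (hx q hq) _]
      exact zero_le_one
  have hrec := ih _ (hn ▸ Finset.card_lt_card hsupp) (c - e) hc' (a - c m) (fun x hx => by
    rw [map_sub, Pi.sub_apply]
    exact sub_le_sub (ha x hx) (hcover x)) rfl
  have hH : (hContent s F).toReal ≤ 10 ^ s * ∑ q ∈ u, w q :=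
    toReal_le_of_le_ofReal (by positivity) (hContent_le_ofReal_sum hs u hcovF)
  have hcoste : fracCost w e = c m * ∑ q ∈ u, w q := by simp [e, Finset.mul_sum]
  rw [map_sub, hcoste] at hrec
  have := mul_le_mul_of_nonneg_left hH hcm
  linarith

theorem hContent_ne_top {d : ℕ} {s : ℝ} (hs : 0 < s) {F : Set (EuclideanSpace ℝ (Fin d))}
    (hF : Bornology.IsBounded F) : hContent s F ≠ ∞ := by
  refine ne_top_of_le_ne_top ?_ (hContent_le_sum hs {()} (fun _ => F) (by simp [iUnion_const]))
  simpa using! ENNReal.rpow_ne_top_of_nonneg hs.le hF.ediam_ne_top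

/-- **Frostman's lemma.** For a compact set `F ⊆ ℝ^d` with `H^s_∞(F) > 0`, `0 < s ≤ d`,
there is a nonzero Borel measure `μ` supported on `F` with `μ(B(x,r)) ≤ r^s` for all `x, r`
and `μ(F) ≥ c H^s_∞(F)`, where `c = c(d) > 0`. -/
theorem frostman_lemma {d : ℕ} (hd : 1 ≤ d) :
    ∃ c : ℝ, 0 < c ∧
      ∀ (s : ℝ), 0 < s → s ≤ d →
      ∀ F : Set (EuclideanSpace ℝ (Fin d)), IsCompact F → 0 < hContent s F →
        ∃ μ : MeasureTheory.Measure (EuclideanSpace ℝ (Fin d)),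
          μ ≠ 0 ∧ μ Fᶜ = 0 ∧
          (∀ (x : EuclideanSpace ℝ (Fin d)) (r : ℝ), 0 < r →
            μ (Metric.ball x r) ≤ ENNReal.ofReal (r ^ s)) ∧
          ENNReal.ofReal c * hContent s F ≤ μ F := by
  refine ⟨(10 ^ (d : ℝ))⁻¹, by positivity, fun s hs hsd F hF hpos => ?_⟩
  have hfin : hContent s F ≠ ∞ := hContent_ne_top hs hF.isBounded
  have hFne : F.Nonempty := by
    by_contra! h
    subst h
    refine hpos.not_ge ?_
    simpa using hContent_le_sum hs (∅ : Finset ℕ) (fun _ => ∅) (empty_subset _)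
  have : Nonempty F := hFne.to_subtype
  have : CompactSpace F := isCompact_iff_compactSpace.1 hF
  obtain ⟨R, hR0, hR⟩ := hF.isBounded.subset_closedBall_lt 0 0
  obtain ⟨μ, hμ, hμB⟩ := exists_measure_of_le_fracCost (X := F)
    (B := fun q : EuclideanSpace ℝ (Fin d) × NNReal => Subtype.val ⁻¹' closedBall q.1 (q.2 : ℝ))
    (w := fun q => (q.2 : ℝ) ^ s) (fun q => by positivity)
    (i₀ := (0, ⟨R, hR0.le⟩)) (eq_univ_of_forall fun x => hR x.2)
    (τ := (10 ^ (d : ℝ))⁻¹ * (hContent s F).toReal) (fun c hc hc1 => by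
      have h := mul_hContent_le_fracCost hs F c hc 1 fun x hx => by
        refine (hc1 ⟨x, hx⟩).trans_eq ?_
        simp only [fracCover, Finsupp.linearCombination_apply, Finsupp.sum, Finset.sum_apply]
        rfl
      have hpow : (10 : ℝ) ^ s ≤ 10 ^ (d : ℝ) :=
        Real.rpow_le_rpow_of_exponent_le (by norm_num) hsd
      rw [one_mul] at h
      rw [inv_mul_le_iff₀ (by positivity)]
      exact h.trans (mul_le_mul_of_nonneg_right hpow
        (fracCost_nonneg (fun q => by positivity) hc)))
  rw [ENNReal.ofReal_mul (by positivity), ofReal_toReal hfin] at hμ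
  have hmap (A : Set (EuclideanSpace ℝ (Fin d))) (hA : MeasurableSet A) :
      μ.map Subtype.val A = μ (Subtype.val ⁻¹' A) :=
    Measure.map_apply measurable_subtype_coe hA
  have hmass : ENNReal.ofReal (10 ^ (d : ℝ))⁻¹ * hContent s F ≤ μ.map Subtype.val F := by
    rw [hmap F hF.measurableSet]
    simpa using hμ
  refine ⟨μ.map Subtype.val, fun h => ?_, ?_, fun x r hr => ?_, hmass⟩
  · rw [h, Measure.coe_zero, Pi.zero_apply] at hmass
    exact hmass.not_gt (ENNReal.mul_pos (by simp) hpos.ne')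
  · rw [hmap _ hF.measurableSet.compl]
    simp
  · rw [hmap _ measurableSet_ball]
    exact hμB (x, ⟨r, hr.le⟩) _ (isOpen_ball.preimage continuous_subtype_val)
      (preimage_mono ball_subset_closedBall)
end
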